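/- Second order differential equations for the MOPUC of the generalized Jacobi weight w(θ) = e^{−ηθ}(sin²(θ/2))^λ (cos²(θ/2))^β: for every n ≥ 3, the following polynomial identities in z hold, with d = λ+β+iη: z(z²−1)Φ_n''(z) + [(d+3−n)z² + 2(λ−β)z + conj(d)+n−1]Φ_n'(z) − [n(d+2)z − (d+n+1)ℓ_{n+1,n} − 2n(β−λ)]Φ_n(z) = −(d+n+1) conj(α_n) Φ_n*(z), and z(1−z²)(Φ_n*)''(z) − [(d+3−n)z² + 2(λ−β)z + conj(d)+n−1](Φ_n*)'(z) + [d(n−2)z − 2n(β−λ) − (d+n)ℓ_{n,n−1} − conj(ℓ_{n+1,n}) − (conj(d)+n) α_n conj(α_{n−1})]Φ_n*(z) = [2(d+n)α_{n−1}z + (conj(d)+n+1)α_n]Φ_n(z). -/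

import Mathlib

open Polynomial MeasureTheory

/-- The functional `z ^ j ↦ c (j + k)` on polynomials. If `c` is the moment sequence of a measure on
the unit circle, this is `p ↦ ∫ p z ^ k`. -/
noncomputable def momentForm (c : ℤ → ℂ) (k : ℤ) : ℂ[X] →ₗ[ℂ] ℂ :=
  Polynomial.lsum fun j => c (j + k) • LinearMap.id

section momentForm

variable {c : ℤ → ℂ}

theorem momentForm_monomial (k : ℤ) (j : ℕ) (a : ℂ) :
    momentForm c k (monomial j a) = c (j + k) * a := by
  simp [momentForm, Polynomial.lsum_apply, Polynomial.sum_monomial_index]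

theorem momentForm_C_mul (k : ℤ) (a : ℂ) (p : ℂ[X]) :
    momentForm c k (C a * p) = a * momentForm c k p := by
  rw [← smul_eq_C_mul, map_smul, smul_eq_mul]

theorem momentForm_X_mul (k : ℤ) (p : ℂ[X]) :
    momentForm c k (X * p) = momentForm c (k + 1) p := by
  induction p using Polynomial.induction_on' with
  | add p q hp hq => simp only [mul_add, map_add, hp, hq]
  | monomial j a =>
    rw [X_mul_monomial, momentForm_monomial, momentForm_monomial]
    congr 2
    push_cast
    ring

theorem momentForm_eq_sum (k : ℤ) {p : ℂ[X]} {N : ℕ} (hp : p.natDegree ≤ N) :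
    momentForm c k p = ∑ j ∈ Finset.range (N + 1), p.coeff j * c (j + k) := by
  conv_lhs => rw [p.as_sum_range' (N + 1) (Nat.lt_succ_of_le hp)]
  simp only [map_sum, momentForm_monomial, mul_comm]

theorem momentForm_conj_reverse (hc : ∀ k, (starRingEnd ℂ) (c k) = c (-k)) (k : ℤ) (p : ℂ[X]) :
    momentForm c k (p.map (starRingEnd ℂ)).reverse =
      (starRingEnd ℂ) (momentForm c (-p.natDegree - k) p) := by
  have hdeg : (p.map (starRingEnd ℂ)).natDegree = p.natDegree := natDegree_map _
  rw [momentForm_eq_sum k ((reverse_natDegree_le _).trans hdeg.le), momentForm_eq_sum _ le_rfl,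
    map_sum, ← Finset.sum_range_reflect]
  refine Finset.sum_congr rfl fun j hj => ?_
  have hj : j ≤ p.natDegree := Nat.lt_succ_iff.1 (Finset.mem_range.1 hj)
  have hsub : p.natDegree + 1 - 1 - j = p.natDegree - j := by omega
  rw [hsub, coeff_reverse, hdeg, revAt_le (Nat.sub_le _ _), Nat.sub_sub_self hj, coeff_map, map_mul,
    hc]
  congr 2
  push_cast [Nat.cast_sub hj]
  ring

/-- The sesquilinear form attached to a Hermitian moment sequence is Hermitian. -/
theorem sum_conj_coeff_mul_momentForm (hc : ∀ k, (starRingEnd ℂ) (c k) = c (-k)) {p q : ℂ[X]}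
    {N : ℕ} (hp : p.natDegree ≤ N) (hq : q.natDegree ≤ N) :
    (starRingEnd ℂ) (∑ j ∈ Finset.range (N + 1),
        (starRingEnd ℂ) (q.coeff j) * momentForm c (-j) p) =
      ∑ j ∈ Finset.range (N + 1), (starRingEnd ℂ) (p.coeff j) * momentForm c (-j) q := by
  simp only [momentForm_eq_sum _ hp, momentForm_eq_sum _ hq, map_sum, map_mul, Finset.mul_sum, hc,
    Complex.conj_conj]
  rw [Finset.sum_comm]
  refine Finset.sum_congr rfl fun i _ => Finset.sum_congr rfl fun j _ => ?_
  have h : (-((i : ℤ) + -j)) = j + -i := by ring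
  rw [h]
  ring

variable {d δ : ℂ}

theorem momentForm_X_sq_sub_one_mul_derivative
    (hrec : ∀ k : ℤ, (k + 1 + d) * c (k + 1) +
      (1 + (starRingEnd ℂ) d - k) * c (k - 1) + 2 * δ * c k = 0) (k : ℤ) (p : ℂ[X]) :
    momentForm c k ((X ^ 2 - 1) * derivative p) =
      -((1 + d + k) * momentForm c (k + 1) p +
        (1 + (starRingEnd ℂ) d - k) * momentForm c (k - 1) p + 2 * δ * momentForm c k p) := by
  induction p using Polynomial.induction_on' with
  | add p q hp hq =>
    simp only [mul_add, map_add, hp, hq]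
    ring
  | monomial j a =>
    have hsplit : ∀ q : ℂ[X], (X ^ 2 - 1) * q = X * (X * q) - q := fun q => by ring
    simp only [hsplit, map_sub, momentForm_X_mul, derivative_monomial, momentForm_monomial]
    rcases j with _ | j
    · have h := hrec k
      simp only [Nat.cast_zero, zero_add, mul_zero, sub_self]
      linear_combination a * h
    · have h := hrec (j + 1 + k)
      have e₁ : ((j + 1 - 1 : ℕ) : ℤ) + (k + 1 + 1) = j + 1 + k + 1 := by simp; ring
      have e₂ : ((j + 1 - 1 : ℕ) : ℤ) + k = j + 1 + k - 1 := by simp; ring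
      have e₃ : ((j + 1 : ℕ) : ℤ) + (k + 1) = j + 1 + k + 1 := by push_cast; ring
      have e₄ : ((j + 1 : ℕ) : ℤ) + (k - 1) = j + 1 + k - 1 := by push_cast; ring
      have e₅ : ((j + 1 : ℕ) : ℤ) + k = j + 1 + k := by push_cast; ring
      rw [e₁, e₂, e₃, e₄, e₅]
      push_cast at h ⊢
      linear_combination a * h

/-- The second order part shared by the differential equations of `Φ n` and `Φ n ^ *`. -/
noncomputable def odeOperator (d δ ν : ℂ) (p : ℂ[X]) : ℂ[X] :=
  X * (X ^ 2 - 1) * derivative (derivative p) +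
    (C (d + 3 - ν) * X ^ 2 + C (2 * δ) * X + C ((starRingEnd ℂ) d + ν - 1)) * derivative p

theorem momentForm_odeOperator
    (hrec : ∀ k : ℤ, (k + 1 + d) * c (k + 1) +
      (1 + (starRingEnd ℂ) d - k) * c (k - 1) + 2 * δ * c k = 0) (ν : ℂ) (k : ℤ) (p : ℂ[X]) :
    momentForm c k (odeOperator d δ ν p) =
      (k + ν - 1) * ((1 + d + k) * momentForm c (k + 1) p +
        (1 + (starRingEnd ℂ) d - k) * momentForm c (k - 1) p + 2 * δ * momentForm c k p) := by
  have hsplit : odeOperator d δ ν p = (X ^ 2 - 1) * derivative (X * derivative p) -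
      (X ^ 2 - 1) * derivative p + (C (d + 3 - ν) * (X * (X * derivative p)) +
        C (2 * δ) * (X * derivative p) + C ((starRingEnd ℂ) d + ν - 1) * derivative p) := by
    simp only [odeOperator, derivative_mul, derivative_X]
    ring
  have h₁ := momentForm_X_sq_sub_one_mul_derivative hrec k p
  have h₂ : momentForm c k ((X ^ 2 - 1) * derivative p) =
      momentForm c (k + 1 + 1) (derivative p) - momentForm c k (derivative p) := by
    rw [← momentForm_X_mul, ← momentForm_X_mul, ← map_sub]
    congr 1
    ring
  rw [hsplit, map_add, map_sub, momentForm_X_sq_sub_one_mul_derivative hrec]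
  simp only [map_add, momentForm_C_mul, momentForm_X_mul, sub_add_cancel]
  linear_combination (1 - ν - k) * h₁ - (2 - ν - k) * h₂

theorem coeff_odeOperator (ν : ℂ) (p : ℂ[X]) (k : ℕ) :
    (odeOperator d δ ν p).coeff (k + 1) =
      k * (k + 2 + d - ν) * p.coeff k + 2 * δ * (k + 1) * p.coeff (k + 1) +
        (k + 2) * ((starRingEnd ℂ) d + ν - 2 - k) * p.coeff (k + 2) := by
  have hsplit : odeOperator d δ ν p = X * (X * (X * derivative (derivative p))) -
      X * derivative (derivative p) + (C (d + 3 - ν) * (X * (X * derivative p)) +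
        C (2 * δ) * (X * derivative p) + C ((starRingEnd ℂ) d + ν - 1) * derivative p) := by
    simp only [odeOperator]
    ring
  rw [hsplit]
  rcases k with _ | _ | k <;>
    simp only [coeff_add, coeff_sub, coeff_C_mul, coeff_X_mul, coeff_derivative, coeff_X_mul_zero,
      zero_add] <;> push_cast <;> ring

end momentForm

section orthogonal

variable {c : ℤ → ℂ} {Φ : ℕ → ℂ[X]} {d δ : ℂ}

theorem momentForm_self_ne_zero
    (hdef : ∀ (N : ℕ) (p : ℂ[X]), p.natDegree ≤ N →
      (∀ k : ℕ, k ≤ N → momentForm c (-k) p = 0) → p = 0)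
    (hmonic : ∀ n, (Φ n).Monic) (hdeg : ∀ n, (Φ n).natDegree = n)
    (horth : ∀ n k : ℕ, k < n → momentForm c (-k) (Φ n) = 0) (n : ℕ) :
    momentForm c (-n) (Φ n) ≠ 0 := fun h =>
  (hmonic n).ne_zero <| hdef n _ (hdeg n).le fun k hk => by
    rcases hk.lt_or_eq with hk | rfl
    · exact horth n k hk
    · exact h

theorem coeff_self_eq_one (hmonic : ∀ n, (Φ n).Monic) (hdeg : ∀ n, (Φ n).natDegree = n) (n : ℕ) :
    (Φ n).coeff n = 1 := by
  have h := (hmonic n).coeff_natDegree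
  rwa [hdeg] at h

theorem conj_momentForm_self (hc : ∀ k, (starRingEnd ℂ) (c k) = c (-k))
    (hmonic : ∀ n, (Φ n).Monic) (hdeg : ∀ n, (Φ n).natDegree = n)
    (horth : ∀ n k : ℕ, k < n → momentForm c (-k) (Φ n) = 0) (n : ℕ) :
    (starRingEnd ℂ) (momentForm c (-n) (Φ n)) = momentForm c (-n) (Φ n) := by
  have h := sum_conj_coeff_mul_momentForm hc (hdeg n).le (hdeg n).le
  have hz : ∑ j ∈ Finset.range n,
      (starRingEnd ℂ) ((Φ n).coeff j) * momentForm c (-j) (Φ n) = 0 :=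
    Finset.sum_eq_zero fun j hj => by rw [horth n j (Finset.mem_range.1 hj), mul_zero]
  simpa [Finset.sum_range_succ, hz, coeff_self_eq_one hmonic hdeg] using h

theorem momentForm_neg_succ (hc : ∀ k, (starRingEnd ℂ) (c k) = c (-k))
    (hmonic : ∀ n, (Φ n).Monic) (hdeg : ∀ n, (Φ n).natDegree = n)
    (horth : ∀ n k : ℕ, k < n → momentForm c (-k) (Φ n) = 0) (n : ℕ) :
    momentForm c (-n - 1) (Φ n) =
      -(starRingEnd ℂ) ((Φ (n + 1)).coeff n) * momentForm c (-n) (Φ n) := by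
  have h := sum_conj_coeff_mul_momentForm hc (p := Φ (n + 1)) (q := Φ n) (N := n + 1)
    (hdeg _).le ((hdeg n).le.trans n.le_succ)
  have hz : ∑ j ∈ Finset.range (n + 1),
      (starRingEnd ℂ) ((Φ n).coeff j) * momentForm c (-j) (Φ (n + 1)) = 0 :=
    Finset.sum_eq_zero fun j hj => by rw [horth _ j (Finset.mem_range.1 hj), mul_zero]
  have hz' : ∑ j ∈ Finset.range n,
      (starRingEnd ℂ) ((Φ (n + 1)).coeff j) * momentForm c (-j) (Φ n) = 0 :=
    Finset.sum_eq_zero fun j hj => by rw [horth _ j (Finset.mem_range.1 hj), mul_zero]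
  have htop : (Φ n).coeff (n + 1) = 0 :=
    coeff_eq_zero_of_natDegree_lt (by rw [hdeg]; exact n.lt_succ_self)
  have hidx : -((n + 1 : ℕ) : ℤ) = -n - 1 := by push_cast; ring
  rw [Finset.sum_range_succ, hz, htop, Finset.sum_range_succ, Finset.sum_range_succ, hz',
    coeff_self_eq_one hmonic hdeg, hidx] at h
  simp only [map_zero, map_one, zero_mul, zero_add, one_mul] at h
  linear_combination -h

theorem coeff_conj_reverse {p : ℂ[X]} {n j : ℕ} (hp : p.natDegree = n) (hj : j ≤ n) :
    (p.map (starRingEnd ℂ)).reverse.coeff j = (starRingEnd ℂ) (p.coeff (n - j)) := by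
  rw [coeff_reverse, natDegree_map, hp, revAt_le hj, coeff_map]

theorem natDegree_conj_reverse_le {p : ℂ[X]} {n : ℕ} (hp : p.natDegree = n) :
    (p.map (starRingEnd ℂ)).reverse.natDegree ≤ n :=
  (reverse_natDegree_le _).trans (by rw [natDegree_map, hp])

/-- The Szegő recurrence. -/
theorem orthogonal_succ (hc : ∀ k, (starRingEnd ℂ) (c k) = c (-k))
    (hdef : ∀ (N : ℕ) (p : ℂ[X]), p.natDegree ≤ N →
      (∀ k : ℕ, k ≤ N → momentForm c (-k) p = 0) → p = 0)
    (hmonic : ∀ n, (Φ n).Monic) (hdeg : ∀ n, (Φ n).natDegree = n)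
    (horth : ∀ n k : ℕ, k < n → momentForm c (-k) (Φ n) = 0) (n : ℕ) :
    Φ (n + 1) = X * Φ n + C ((Φ (n + 1)).coeff 0) * ((Φ n).map (starRingEnd ℂ)).reverse := by
  set q := ((Φ n).map (starRingEnd ℂ)).reverse with hq
  set h := momentForm c (-n) (Φ n) with hh
  have hreal : (starRingEnd ℂ) h = h := conj_momentForm_self hc hmonic hdeg horth n
  have hne : h ≠ 0 := momentForm_self_ne_zero hdef hmonic hdeg horth n
  have hq₀ : q.coeff 0 = 1 := by
    rw [hq, coeff_conj_reverse (hdeg n) n.zero_le, Nat.sub_zero, coeff_self_eq_one hmonic hdeg,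
      map_one]
  have hzero : C h * (Φ (n + 1) - X * Φ n) + C (momentForm c 1 (Φ n)) * q = 0 := by
    refine hdef n _ ?_ fun k hk => ?_
    · refine natDegree_le_iff_coeff_eq_zero.2 fun N hN => ?_
      obtain ⟨N, rfl⟩ : ∃ M, N = M + 1 := ⟨N - 1, by omega⟩
      rw [coeff_add, coeff_C_mul, coeff_C_mul, coeff_sub, coeff_X_mul,
        coeff_eq_zero_of_natDegree_lt ((natDegree_conj_reverse_le (hdeg n)).trans_lt hN)]
      rcases (Nat.lt_succ_iff.1 hN).eq_or_lt with rfl | hN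
      · simp [coeff_self_eq_one hmonic hdeg]
      · rw [coeff_eq_zero_of_natDegree_lt (by rw [hdeg]; omega),
          coeff_eq_zero_of_natDegree_lt (by rw [hdeg]; omega)]
        simp
    · rw [map_add, momentForm_C_mul, momentForm_C_mul, map_sub, momentForm_X_mul,
        horth (n + 1) k (by omega), hq, momentForm_conj_reverse hc, hdeg]
      rcases k with _ | k
      · have hidx : -(n : ℤ) - -((0 : ℕ) : ℤ) = -n := by simp
        rw [hidx, ← hh, hreal]
        simp
        ring
      · have hidx : -(n : ℤ) - -((k + 1 : ℕ) : ℤ) = -((n - (k + 1) : ℕ) : ℤ) := by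
          push_cast [Nat.cast_sub hk]; ring
        have hidx' : -((k + 1 : ℕ) : ℤ) + 1 = -(k : ℤ) := by push_cast; ring
        rw [hidx, hidx', horth n k (by omega), horth n (n - (k + 1)) (by omega)]
        simp
  have hcoeff := congrArg (fun p => p.coeff 0) hzero
  simp only [coeff_add, coeff_C_mul, coeff_sub, coeff_X_mul_zero, hq₀, coeff_zero, sub_zero,
    mul_one] at hcoeff
  rw [eq_neg_of_add_eq_zero_right hcoeff, C_neg, C_mul] at hzero
  have hC : (C h : ℂ[X]) ≠ 0 := C_ne_zero.2 hne
  refine mul_left_cancel₀ hC ?_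
  linear_combination hzero

theorem momentForm_one (hc : ∀ k, (starRingEnd ℂ) (c k) = c (-k))
    (hdef : ∀ (N : ℕ) (p : ℂ[X]), p.natDegree ≤ N →
      (∀ k : ℕ, k ≤ N → momentForm c (-k) p = 0) → p = 0)
    (hmonic : ∀ n, (Φ n).Monic) (hdeg : ∀ n, (Φ n).natDegree = n)
    (horth : ∀ n k : ℕ, k < n → momentForm c (-k) (Φ n) = 0) (n : ℕ) :
    momentForm c 1 (Φ n) = -(Φ (n + 1)).coeff 0 * momentForm c (-n) (Φ n) := by
  have h := congrArg (momentForm c 0) (orthogonal_succ hc hdef hmonic hdeg horth n)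
  have h₀ := horth (n + 1) 0 n.succ_pos
  rw [Nat.cast_zero, neg_zero] at h₀
  rw [h₀, map_add, momentForm_X_mul, momentForm_C_mul, momentForm_conj_reverse hc, hdeg, sub_zero,
    conj_momentForm_self hc hmonic hdeg horth, zero_add] at h
  linear_combination -h

theorem coeff_succ_sub_coeff (hc : ∀ k, (starRingEnd ℂ) (c k) = c (-k))
    (hdef : ∀ (N : ℕ) (p : ℂ[X]), p.natDegree ≤ N →
      (∀ k : ℕ, k ≤ N → momentForm c (-k) p = 0) → p = 0)
    (hmonic : ∀ n, (Φ n).Monic) (hdeg : ∀ n, (Φ n).natDegree = n)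
    (horth : ∀ n k : ℕ, k < n → momentForm c (-k) (Φ n) = 0) (n : ℕ) :
    (Φ (n + 2)).coeff (n + 1) = (Φ (n + 1)).coeff n +
      (Φ (n + 2)).coeff 0 * (starRingEnd ℂ) ((Φ (n + 1)).coeff 0) := by
  have h := congrArg (fun p => p.coeff (n + 1)) (orthogonal_succ hc hdef hmonic hdeg horth (n + 1))
  simpa [coeff_conj_reverse (hdeg (n + 1)) le_rfl, coeff_X_mul] using h

/-- The differential equation of `Φ n`, with its zeroth order coefficient in a form that comes
directly from orthogonality. -/
theorem odeOperator_orthogonal (hc : ∀ k, (starRingEnd ℂ) (c k) = c (-k))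
    (hrec : ∀ k : ℤ, (k + 1 + d) * c (k + 1) +
      (1 + (starRingEnd ℂ) d - k) * c (k - 1) + 2 * δ * c k = 0)
    (hdef : ∀ (N : ℕ) (p : ℂ[X]), p.natDegree ≤ N →
      (∀ k : ℕ, k ≤ N → momentForm c (-k) p = 0) → p = 0)
    (hmonic : ∀ n, (Φ n).Monic) (hdeg : ∀ n, (Φ n).natDegree = n)
    (horth : ∀ n k : ℕ, k < n → momentForm c (-k) (Φ n) = 0) {n : ℕ} (hn : 2 ≤ n) :
    odeOperator d δ n (Φ n) - C (n * (d + 2)) * (X * Φ n) +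
      C (2 * δ - (1 + (starRingEnd ℂ) d + n) * (starRingEnd ℂ) ((Φ (n + 1)).coeff n)) * Φ n =
    C ((d + n + 1) * (Φ (n + 1)).coeff 0) * ((Φ n).map (starRingEnd ℂ)).reverse := by
  have hreal := conj_momentForm_self hc hmonic hdeg horth n
  have hone := momentForm_one hc hdef hmonic hdeg horth n
  have hsucc := momentForm_neg_succ hc hmonic hdeg horth n
  rw [← sub_eq_zero]
  refine hdef n _ ?_ fun k hk => ?_
  · refine natDegree_le_iff_coeff_eq_zero.2 fun N hN => ?_
    obtain ⟨N, rfl⟩ : ∃ M, N = M + 1 := ⟨N - 1, by omega⟩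
    rw [coeff_sub, coeff_add, coeff_sub, coeff_odeOperator, coeff_C_mul, coeff_C_mul, coeff_C_mul,
      coeff_X_mul,
      coeff_eq_zero_of_natDegree_lt ((natDegree_conj_reverse_le (hdeg n)).trans_lt hN),
      coeff_eq_zero_of_natDegree_lt (p := Φ n) (n := N + 1) (by rw [hdeg]; omega),
      coeff_eq_zero_of_natDegree_lt (p := Φ n) (n := N + 2) (by rw [hdeg]; omega)]
    rcases (Nat.lt_succ_iff.1 hN).eq_or_lt with rfl | hN
    · ring
    · rw [coeff_eq_zero_of_natDegree_lt (p := Φ n) (by rw [hdeg]; omega)]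
      ring
  · rw [map_sub, map_add, map_sub, momentForm_C_mul, momentForm_C_mul, momentForm_C_mul,
      momentForm_X_mul, momentForm_odeOperator hrec, momentForm_conj_reverse hc, hdeg]
    have hrev : ∀ j : ℕ, j + k = n → j < n →
        momentForm c (-(n : ℤ) - -(k : ℤ)) (Φ n) = 0 := fun j hj hjn => by
      have hidx : -(n : ℤ) - -(k : ℤ) = -(j : ℤ) := by omega
      rw [hidx, horth n j hjn]
    have hpred : ∀ j : ℕ, j + 1 = k → momentForm c (-(k : ℤ) + 1) (Φ n) = 0 := fun j hj => by
      have hidx : -(k : ℤ) + 1 = -(j : ℤ) := by omega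
      rw [hidx, horth n j (by omega)]
    have hnext : k + 1 < n → momentForm c (-(k : ℤ) - 1) (Φ n) = 0 := fun hk => by
      have hidx : -(k : ℤ) - 1 = -((k + 1 : ℕ) : ℤ) := by omega
      rw [hidx, horth n _ hk]
    rcases Nat.eq_zero_or_pos k with rfl | hkpos
    · rw [hnext (by omega), horth n 0 (by omega)]
      simp only [Nat.cast_zero, neg_zero, zero_add, sub_zero, Int.cast_zero]
      rw [hreal, hone]
      ring
    · rw [hpred (k - 1) (by omega)]
      rcases lt_trichotomy (k + 1) n with hkn | rfl | hkn
      · rw [hnext hkn, horth n k (by omega), hrev (n - k) (by omega) (by omega)]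
        simp
      · rw [horth (k + 1) k (by omega), hrev 1 (by omega) (by omega)]
        push_cast
        simp
      · obtain rfl : k = n := by omega
        have h₀ := horth k 0 (by omega)
        rw [Nat.cast_zero, neg_zero] at h₀
        rw [hsucc, sub_self, h₀]
        push_cast
        simp
        ring

theorem coeff_add_conj_coeff (hc : ∀ k, (starRingEnd ℂ) (c k) = c (-k))
    (hrec : ∀ k : ℤ, (k + 1 + d) * c (k + 1) +
      (1 + (starRingEnd ℂ) d - k) * c (k - 1) + 2 * δ * c k = 0)
    (hdef : ∀ (N : ℕ) (p : ℂ[X]), p.natDegree ≤ N →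
      (∀ k : ℕ, k ≤ N → momentForm c (-k) p = 0) → p = 0)
    (hmonic : ∀ n, (Φ n).Monic) (hdeg : ∀ n, (Φ n).natDegree = n)
    (horth : ∀ n k : ℕ, k < n → momentForm c (-k) (Φ n) = 0) {n : ℕ} (hn : 2 ≤ n) :
    (d + n + 1) * (Φ (n + 1)).coeff n +
      ((starRingEnd ℂ) d + n + 1) * (starRingEnd ℂ) ((Φ (n + 1)).coeff n) =
    2 * (n + 1) * δ := by
  have h := odeOperator_orthogonal hc hrec hdef hmonic hdeg horth hn
  obtain ⟨m, rfl⟩ : ∃ m, n = m + 1 := ⟨n - 1, by omega⟩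
  have hstep := coeff_succ_sub_coeff hc hdef hmonic hdeg horth m
  replace h := congrArg (fun p => p.coeff (m + 1)) h
  simp only [coeff_add, coeff_sub, coeff_odeOperator, coeff_C_mul, coeff_X_mul,
    coeff_self_eq_one hmonic hdeg, coeff_conj_reverse (hdeg (m + 1)) le_rfl, Nat.sub_self,
    coeff_eq_zero_of_natDegree_lt (p := Φ (m + 1)) (n := m + 2) (by rw [hdeg]; omega)] at h
  push_cast at h ⊢
  linear_combination -h + (d + m + 2) * hstep

/-- The differential equation of `Φ n ^ *`, with its zeroth order coefficient in a form that comes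
directly from orthogonality. -/
theorem odeOperator_conj_reverse (hc : ∀ k, (starRingEnd ℂ) (c k) = c (-k))
    (hrec : ∀ k : ℤ, (k + 1 + d) * c (k + 1) +
      (1 + (starRingEnd ℂ) d - k) * c (k - 1) + 2 * δ * c k = 0)
    (hdef : ∀ (N : ℕ) (p : ℂ[X]), p.natDegree ≤ N →
      (∀ k : ℕ, k ≤ N → momentForm c (-k) p = 0) → p = 0)
    (hmonic : ∀ n, (Φ n).Monic) (hdeg : ∀ n, (Φ n).natDegree = n)
    (horth : ∀ n k : ℕ, k < n → momentForm c (-k) (Φ n) = 0) {n : ℕ} (hn : 2 ≤ n) :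
    C (d * (n - 2)) * (X * ((Φ n).map (starRingEnd ℂ)).reverse) -
        odeOperator d δ n ((Φ n).map (starRingEnd ℂ)).reverse +
        C (2 * (d + n) * (starRingEnd ℂ) ((Φ n).coeff 0)) * (X * Φ n) =
      C ((n + d - 1) * (Φ (n + 1)).coeff n + 2 * (1 - n) * δ -
          2 * (d + n) * (starRingEnd ℂ) ((Φ n).coeff 0) * (Φ (n + 1)).coeff 0) *
        ((Φ n).map (starRingEnd ℂ)).reverse -
      C (((starRingEnd ℂ) d + n + 1) * (starRingEnd ℂ) ((Φ (n + 1)).coeff 0)) * Φ n := by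
  have hreal := conj_momentForm_self hc hmonic hdeg horth n
  have hone := momentForm_one hc hdef hmonic hdeg horth n
  have hsucc := momentForm_neg_succ hc hmonic hdeg horth n
  have hqdeg := natDegree_conj_reverse_le (hdeg n)
  set q := ((Φ n).map (starRingEnd ℂ)).reverse with hq
  have hqzero : ∀ k : ℤ, ∀ j : ℕ, -(n : ℤ) - k = -j → j < n → momentForm c k q = 0 :=
    fun k j hj hjn => by
      rw [hq, momentForm_conj_reverse hc, hdeg, hj, horth n j hjn, map_zero]
  rw [← sub_eq_zero]
  refine hdef n _ ?_ fun k hk => ?_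
  · refine natDegree_le_iff_coeff_eq_zero.2 fun N hN => ?_
    obtain ⟨N, rfl⟩ : ∃ M, N = M + 1 := ⟨N - 1, by omega⟩
    simp only [coeff_sub, coeff_add, coeff_odeOperator, coeff_C_mul, coeff_X_mul,
      coeff_eq_zero_of_natDegree_lt (p := q) (n := N + 1) (by omega),
      coeff_eq_zero_of_natDegree_lt (p := q) (n := N + 2) (by omega),
      coeff_eq_zero_of_natDegree_lt (p := Φ n) (n := N + 1) (by rw [hdeg]; omega)]
    rcases (Nat.lt_succ_iff.1 hN).eq_or_lt with rfl | hN
    · rw [hq, coeff_conj_reverse (hdeg n) le_rfl, coeff_self_eq_one hmonic hdeg, Nat.sub_self]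
      ring
    · rw [coeff_eq_zero_of_natDegree_lt (p := Φ n) (n := N) (by rw [hdeg]; omega),
        coeff_eq_zero_of_natDegree_lt (p := q) (n := N) (by omega)]
      ring
  · simp only [map_sub (momentForm c (-(k : ℤ))), map_add (momentForm c (-(k : ℤ))),
      momentForm_C_mul, momentForm_X_mul, momentForm_odeOperator hrec]
    rcases Nat.eq_zero_or_pos k with rfl | hkpos
    · have h₀ := horth n 0 (by omega)
      simp only [Nat.cast_zero, neg_zero, zero_add, zero_sub, Int.cast_zero] at h₀ ⊢
      have hq₀ : momentForm c 0 q = momentForm c (-n) (Φ n) := by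
        rw [hq, momentForm_conj_reverse hc, hdeg, sub_zero, hreal]
      have hq₁ : momentForm c 1 q = -(Φ (n + 1)).coeff n * momentForm c (-n) (Φ n) := by
        rw [hq, momentForm_conj_reverse hc, hdeg, hsucc, map_mul, hreal, map_neg, Complex.conj_conj]
      rw [h₀, hqzero (-1) (n - 1) (by omega) (by omega), hq₀, hq₁, hone]
      ring
    · rw [hqzero (-k) (n - k) (by omega) (by omega)]
      have hpred : momentForm c (-(k : ℤ) + 1) (Φ n) = 0 := by
        have hidx : -(k : ℤ) + 1 = -((k - 1 : ℕ) : ℤ) := by omega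
        rw [hidx, horth n _ (by omega)]
      rw [hpred]
      rcases hk.lt_or_eq with hkn | rfl
      · rw [hqzero (-k - 1) (n - k - 1) (by omega) (by omega), horth n k hkn]
        rcases Nat.lt_or_ge k 2 with hk2 | hk2
        · obtain rfl : k = 1 := by omega
          push_cast
          ring
        · rw [hqzero (-k + 1) (n - k + 1) (by omega) (by omega)]
          ring
      · have hqtop : momentForm c (-k - 1) q =
            -(starRingEnd ℂ) ((Φ (k + 1)).coeff 0) * momentForm c (-k) (Φ k) := by
          have hidx : -(k : ℤ) - (-k - 1) = 1 := by ring
          rw [hq, momentForm_conj_reverse hc, hdeg, hidx, hone, map_mul, hreal, map_neg]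
        rw [hqtop, hqzero (-k + 1) 1 (by omega) (by omega)]
        push_cast
        ring

end orthogonal

section trigMoment

/-- The trigonometric moments of the weight `w` on `[0, 2π]`. -/
noncomputable def trigMoment (w : ℝ → ℝ) (k : ℤ) : ℂ :=
  ∫ θ in (0 : ℝ)..(2 * Real.pi), Complex.exp (k * θ * Complex.I) * (w θ : ℂ)

variable {w : ℝ → ℝ}

theorem conj_trigMoment (k : ℤ) : (starRingEnd ℂ) (trigMoment w k) = trigMoment w (-k) := by
  rw [trigMoment, trigMoment, intervalIntegral.integral_of_le (by positivity),
    intervalIntegral.integral_of_le (by positivity), ← integral_conj]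
  refine integral_congr_ae (Filter.Eventually.of_forall fun θ => ?_)
  simp [← Complex.exp_conj]

theorem intervalIntegrable_mul_weight (hw : IntervalIntegrable w volume 0 (2 * Real.pi))
    {f : ℝ → ℂ} (hf : Continuous f) :
    IntervalIntegrable (fun θ => f θ * (w θ : ℂ)) volume 0 (2 * Real.pi) :=
  IntervalIntegrable.continuousOn_mul ⟨hw.1.ofReal, hw.2.ofReal⟩ hf.continuousOn

theorem integral_eval_exp_mul (hw : IntervalIntegrable w volume 0 (2 * Real.pi)) (k : ℤ)
    (p : ℂ[X]) :
    ∫ θ in (0 : ℝ)..(2 * Real.pi),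
        p.eval (Complex.exp (θ * Complex.I)) * Complex.exp (k * θ * Complex.I) * (w θ : ℂ) =
      momentForm (trigMoment w) k p := by
  rw [momentForm_eq_sum k le_rfl]
  have hexpand : ∀ θ : ℝ,
      p.eval (Complex.exp (θ * Complex.I)) * Complex.exp (k * θ * Complex.I) * (w θ : ℂ) =
      ∑ j ∈ Finset.range (p.natDegree + 1),
        p.coeff j * (Complex.exp (((j + k : ℤ) : ℂ) * θ * Complex.I) * (w θ : ℂ)) := fun θ => by
    rw [eval_eq_sum_range, Finset.sum_mul, Finset.sum_mul]
    refine Finset.sum_congr rfl fun j _ => ?_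
    have h : ((j + k : ℤ) : ℂ) * θ * Complex.I = j * (θ * Complex.I) + k * θ * Complex.I := by
      push_cast
      ring
    rw [h, Complex.exp_add, Complex.exp_nat_mul]
    ring
  simp only [hexpand]
  rw [intervalIntegral.integral_finsetSum fun j _ =>
    (intervalIntegrable_mul_weight hw (by fun_prop)).const_mul _]
  simp only [intervalIntegral.integral_const_mul, trigMoment]

theorem integral_norm_sq_mul_weight (hw : IntervalIntegrable w volume 0 (2 * Real.pi)) (p : ℂ[X]) :
    ((∫ θ in (0 : ℝ)..(2 * Real.pi),
        Complex.normSq (p.eval (Complex.exp (θ * Complex.I))) * w θ : ℝ) : ℂ) =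
      ∑ j ∈ Finset.range (p.natDegree + 1),
        (starRingEnd ℂ) (p.coeff j) * momentForm (trigMoment w) (-j) p := by
  have hexpand : ∀ θ : ℝ,
      ((Complex.normSq (p.eval (Complex.exp (θ * Complex.I))) * w θ : ℝ) : ℂ) =
      ∑ j ∈ Finset.range (p.natDegree + 1), (starRingEnd ℂ) (p.coeff j) *
        (p.eval (Complex.exp (θ * Complex.I)) * Complex.exp ((-j : ℤ) * θ * Complex.I) *
          (w θ : ℂ)) := fun θ => by
    rw [Complex.ofReal_mul, ← Complex.mul_conj]
    conv_lhs => rw [eval_eq_sum_range (p := p), map_sum, Finset.mul_sum, Finset.sum_mul,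
      ← eval_eq_sum_range (p := p)]
    refine Finset.sum_congr rfl fun j _ => ?_
    have h : ((-j : ℤ) : ℂ) * θ * Complex.I = j * (-(θ * Complex.I)) := by
      push_cast
      ring
    rw [h, Complex.exp_nat_mul, map_mul, map_pow, ← Complex.exp_conj, map_mul, Complex.conj_ofReal,
      Complex.conj_I, mul_neg]
    ring
  rw [← intervalIntegral.integral_ofReal]
  simp only [hexpand]
  rw [intervalIntegral.integral_finsetSum fun j _ =>
    (intervalIntegrable_mul_weight hw (by fun_prop)).const_mul _]
  simp only [intervalIntegral.integral_const_mul, integral_eval_exp_mul hw]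

theorem eq_zero_of_eval_exp_eq_zero {p : ℂ[X]}
    (hp : ∀ θ ∈ Set.Ioo 0 Real.pi, p.eval (Complex.exp (θ * Complex.I)) = 0) : p = 0 := by
  refine eq_zero_of_infinite_isRoot p ?_
  have hinj : Set.InjOn (fun θ : ℝ => Complex.exp (θ * Complex.I)) (Set.Ioo 0 Real.pi) := by
    intro x hx y hy hxy
    have h := congrArg Complex.re hxy
    simp only [Complex.exp_ofReal_mul_I_re] at h
    exact Real.injOn_cos ⟨hx.1.le, hx.2.le⟩ ⟨hy.1.le, hy.2.le⟩ h
  refine Set.Infinite.mono ?_ ((Set.Ioo_infinite Real.pi_pos).image hinj)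
  rintro _ ⟨θ, hθ, rfl⟩
  exact hp θ hθ

theorem eq_zero_of_momentForm_eq_zero (hw : IntervalIntegrable w volume 0 (2 * Real.pi))
    (hnonneg : ∀ θ, 0 ≤ w θ) (hpos : ∀ θ ∈ Set.Ioo 0 Real.pi, 0 < w θ) (N : ℕ) (p : ℂ[X])
    (hp : p.natDegree ≤ N) (h : ∀ k : ℕ, k ≤ N → momentForm (trigMoment w) (-k) p = 0) :
    p = 0 := by
  set f : ℝ → ℝ := fun θ => Complex.normSq (p.eval (Complex.exp (θ * Complex.I))) with hf
  have hcont : Continuous f := Complex.continuous_normSq.comp (by fun_prop)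
  have hinteg : ∫ θ in (0 : ℝ)..(2 * Real.pi), f θ * w θ = 0 := by
    rw [← Complex.ofReal_eq_zero, hf, integral_norm_sq_mul_weight hw]
    refine Finset.sum_eq_zero fun j hj => ?_
    rw [h j ((Nat.lt_succ_iff.1 (Finset.mem_range.1 hj)).trans hp), mul_zero]
  have hae := (intervalIntegral.integral_eq_zero_iff_of_le_of_nonneg_ae
    (by positivity) (Filter.Eventually.of_forall fun θ =>
      mul_nonneg (Complex.normSq_nonneg _) (hnonneg θ))
    (hw.continuousOn_mul hcont.continuousOn)).1 hinteg
  have hae' : f =ᵐ[volume.restrict (Set.Ioo 0 Real.pi)] fun _ => 0 := by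
    have hsub : Set.Ioo 0 Real.pi ⊆ Set.Ioc 0 (2 * Real.pi) := fun θ hθ =>
      ⟨hθ.1, by linarith [hθ.2, Real.pi_pos]⟩
    filter_upwards [ae_restrict_of_ae_restrict_of_subset hsub hae,
      ae_restrict_mem measurableSet_Ioo] with θ hθ hmem
    exact (mul_eq_zero.1 hθ).resolve_right (hpos θ hmem).ne'
  have heq := Measure.eqOn_open_of_ae_eq hae' isOpen_Ioo hcont.continuousOn continuousOn_const
  exact eq_zero_of_eval_exp_eq_zero fun θ hθ => Complex.normSq_eq_zero.1 (heq hθ)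

end trigMoment

section weight

/-- An antiderivative of `(1 + 2 * a) * (x ^ 2) ^ a`. -/
theorem hasDerivAt_mul_sq_rpow (a : ℝ) {x : ℝ} (hx : x ≠ 0) :
    HasDerivAt (fun y : ℝ => y * (y ^ 2) ^ a) ((1 + 2 * a) * (x ^ 2) ^ a) x := by
  have hsq : x ^ 2 ≠ 0 := pow_ne_zero 2 hx
  have h := (hasDerivAt_id x).mul ((hasDerivAt_pow 2 x).rpow_const (p := a) (Or.inl hsq))
  refine h.congr_deriv ?_
  rw [Real.rpow_sub_one hsq]
  simp
  field_simp

theorem continuous_mul_sq_rpow {a : ℝ} (ha : -1 / 2 < a) :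
    Continuous fun y : ℝ => y * (y ^ 2) ^ a := by
  refine continuous_iff_continuousAt.2 fun x => ?_
  rcases ne_or_eq x 0 with hx | rfl
  · exact (hasDerivAt_mul_sq_rpow a hx).continuousAt
  · have hnorm : ∀ y : ℝ, ‖y * (y ^ 2) ^ a‖ = |y| ^ (1 + 2 * a) := fun y => by
      rw [norm_mul, Real.norm_eq_abs, Real.norm_eq_abs,
        abs_of_nonneg (Real.rpow_nonneg (sq_nonneg y) a), ← sq_abs,
        ← Real.rpow_natCast, ← Real.rpow_mul (abs_nonneg y), Nat.cast_ofNat]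
      rcases eq_or_ne y 0 with rfl | hy
      · rw [abs_zero, zero_mul, Real.zero_rpow (by linarith)]
      · rw [Real.rpow_add (abs_pos.2 hy), Real.rpow_one]
    rw [ContinuousAt, zero_mul, tendsto_zero_iff_norm_tendsto_zero]
    simp only [hnorm]
    have hcont : Continuous fun y : ℝ => |y| ^ (1 + 2 * a) :=
      continuous_abs.rpow_const fun _ => Or.inr (by linarith)
    have h := hcont.tendsto 0
    rwa [abs_zero, Real.zero_rpow (by linarith)] at h

theorem intervalIntegrable_sq_rpow_mul_deriv {r : ℝ} (hr : -1 / 2 < r) {u u' : ℝ → ℝ} {a b : ℝ}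
    (hab : a ≤ b) (hu : ∀ x, HasDerivAt u (u' x) x) (hne : ∀ x ∈ Set.Ioo a b, u x ≠ 0)
    (hpos : ∀ x ∈ Set.Ioo a b, 0 ≤ u' x) :
    IntervalIntegrable (fun x => (u x ^ 2) ^ r * u' x) volume a b := by
  have hcont : Continuous u := continuous_iff_continuousAt.2 fun x => (hu x).continuousAt
  have h : IntervalIntegrable (fun x => (1 + 2 * r) * (u x ^ 2) ^ r * u' x) volume a b := by
    refine intervalIntegral.intervalIntegrable_deriv_of_nonneg
      ((continuous_mul_sq_rpow hr).comp hcont).continuousOn ?_ ?_ <;>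
      rw [min_eq_left hab, max_eq_right hab] <;> intro x hx
    · exact (hasDerivAt_mul_sq_rpow r (hne x hx)).comp x (hu x)
    · have := hpos x hx
      have := Real.rpow_nonneg (sq_nonneg (u x)) r
      have : 0 ≤ 1 + 2 * r := by linarith
      positivity
  refine (h.const_mul (1 + 2 * r)⁻¹).congr fun x _ => ?_
  have : 1 + 2 * r ≠ 0 := by linarith
  field_simp

theorem hasDerivAt_sin_half (x : ℝ) :
    HasDerivAt (fun θ : ℝ => Real.sin (θ / 2)) (Real.cos (x / 2) / 2) x := by
  have h := ((hasDerivAt_id x).div_const 2).sin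
  simpa [div_eq_mul_inv] using h

theorem hasDerivAt_cos_half (x : ℝ) :
    HasDerivAt (fun θ : ℝ => Real.cos (θ / 2)) (-Real.sin (x / 2) / 2) x := by
  have h := ((hasDerivAt_id x).div_const 2).cos
  simpa [div_eq_mul_inv] using h

theorem sin_half_pos {x : ℝ} (h₀ : 0 < x) (h₁ : x < 2 * Real.pi) : 0 < Real.sin (x / 2) :=
  Real.sin_pos_of_pos_of_lt_pi (by linarith) (by linarith)

theorem cos_half_pos {x : ℝ} (h₀ : 0 < x) (h₁ : x < Real.pi) : 0 < Real.cos (x / 2) :=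
  Real.cos_pos_of_mem_Ioo ⟨by linarith [Real.pi_pos], by linarith⟩

theorem cos_half_neg {x : ℝ} (h₀ : Real.pi < x) (h₁ : x < 2 * Real.pi) : Real.cos (x / 2) < 0 :=
  Real.cos_neg_of_pi_div_two_lt_of_lt (by linarith) (by linarith)

theorem intervalIntegrable_sin_sq_rpow_mul_cos {lam : ℝ} (hlam : -1 / 2 < lam) :
    IntervalIntegrable (fun θ : ℝ => (Real.sin (θ / 2) ^ 2) ^ lam * Real.cos (θ / 2))
      volume 0 (2 * Real.pi) := by
  have hπ := Real.pi_pos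
  refine IntervalIntegrable.trans (b := Real.pi) ?_ ?_
  · refine ((intervalIntegrable_sq_rpow_mul_deriv hlam hπ.le hasDerivAt_sin_half
      (fun x hx => (sin_half_pos hx.1 (by linarith [hx.2])).ne')
      fun x hx => by linarith [cos_half_pos hx.1 hx.2]).const_mul 2).congr fun x _ => ?_
    ring
  · refine ((intervalIntegrable_sq_rpow_mul_deriv hlam (by linarith)
      (fun x => (hasDerivAt_sin_half x).neg)
      (fun x hx => neg_ne_zero.2 (sin_half_pos (by linarith [hx.1]) hx.2).ne')
      fun x hx => by linarith [cos_half_neg hx.1 hx.2]).const_mul (-2)).congr fun x _ => ?_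
    simp only [Pi.neg_apply, neg_sq]
    ring

theorem intervalIntegrable_cos_sq_rpow_mul_sin {β : ℝ} (hβ : -1 / 2 < β) :
    IntervalIntegrable (fun θ : ℝ => (Real.cos (θ / 2) ^ 2) ^ β * Real.sin (θ / 2))
      volume 0 (2 * Real.pi) := by
  have hπ := Real.pi_pos
  refine IntervalIntegrable.trans (b := Real.pi) ?_ ?_ <;>
    refine ((intervalIntegrable_sq_rpow_mul_deriv hβ (by linarith)
      (fun x => (hasDerivAt_cos_half x).neg) (fun x hx => neg_ne_zero.2 ?_)
      fun x hx => ?_).const_mul 2).congr fun x _ => by simp only [Pi.neg_apply, neg_sq]; ring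
  · exact (cos_half_pos hx.1 hx.2).ne'
  · linarith [sin_half_pos hx.1 (by linarith [hx.2])]
  · exact (cos_half_neg hx.1 hx.2).ne
  · linarith [sin_half_pos (by linarith [hx.1]) hx.2]

theorem sq_rpow_mul_sq (a x : ℝ) :
    (x ^ 2) ^ a * x ^ 2 = (x ^ 2) ^ (a + 1 / 2) * |x| := by
  rcases eq_or_ne x 0 with rfl | hx
  · simp
  · rw [Real.rpow_add (by positivity), ← Real.sqrt_eq_rpow, Real.sqrt_sq_eq_abs, mul_assoc,
      abs_mul_abs_self, sq]

/-- The generalized Jacobi weight on the unit circle. -/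
noncomputable def jacobiWeight (lam β η θ : ℝ) : ℝ :=
  Real.exp (-η * θ) * (Real.sin (θ / 2) ^ 2) ^ lam * (Real.cos (θ / 2) ^ 2) ^ β

variable {lam β : ℝ}

theorem intervalIntegrable_jacobiWeight (hlam : -1 / 2 < lam) (hβ : -1 / 2 < β) (η : ℝ) :
    IntervalIntegrable (jacobiWeight lam β η) volume 0 (2 * Real.pi) := by
  have hs : Continuous fun θ : ℝ => Real.exp (-η * θ) * (Real.sin (θ / 2) ^ 2) ^ (lam + 1 / 2) :=
    Continuous.mul (by fun_prop)
      (Continuous.rpow_const (by fun_prop) fun _ => Or.inr (by linarith))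
  have hc : Continuous fun θ : ℝ => Real.exp (-η * θ) * (Real.cos (θ / 2) ^ 2) ^ (β + 1 / 2) :=
    Continuous.mul (by fun_prop)
      (Continuous.rpow_const (by fun_prop) fun _ => Or.inr (by linarith))
  refine (((intervalIntegrable_cos_sq_rpow_mul_sin hβ).norm.continuousOn_mul hs.continuousOn).add
    ((intervalIntegrable_sin_sq_rpow_mul_cos hlam).norm.continuousOn_mul hc.continuousOn)).congr
    fun θ _ => ?_
  have h₁ := sq_rpow_mul_sq lam (Real.sin (θ / 2))
  have h₂ := sq_rpow_mul_sq β (Real.cos (θ / 2))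
  simp only [norm_mul, Real.norm_eq_abs, abs_of_nonneg (Real.rpow_nonneg (sq_nonneg _) _),
    jacobiWeight]
  linear_combination (-Real.exp (-η * θ) * (Real.cos (θ / 2) ^ 2) ^ β) * h₁ -
    Real.exp (-η * θ) * (Real.sin (θ / 2) ^ 2) ^ lam * h₂ +
    Real.exp (-η * θ) * (Real.sin (θ / 2) ^ 2) ^ lam * (Real.cos (θ / 2) ^ 2) ^ β *
      Real.sin_sq_add_cos_sq (θ / 2)

theorem jacobiWeight_nonneg (lam β η θ : ℝ) : 0 ≤ jacobiWeight lam β η θ := by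
  unfold jacobiWeight
  positivity

theorem jacobiWeight_pos (lam β η : ℝ) {θ : ℝ} (hθ : θ ∈ Set.Ioo 0 Real.pi) :
    0 < jacobiWeight lam β η θ := by
  have := sin_half_pos hθ.1 (by linarith [hθ.2, Real.pi_pos])
  have := cos_half_pos hθ.1 hθ.2
  unfold jacobiWeight
  positivity

/-- The Pearson equation: `sin θ * exp (i k θ) * w θ` integrates to boundary terms, which vanish. -/
theorem integral_deriv_sin_mul_exp_mul_jacobiWeight (hlam : -1 / 2 < lam) (hβ : -1 / 2 < β)
    (η : ℝ) (k : ℤ) :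
    ∫ θ in (0 : ℝ)..(2 * Real.pi), (Complex.exp (k * θ * Complex.I) *
      ((k * Complex.I - η) * Real.sin θ + (1 + lam + β) * Real.cos θ + (lam - β))) *
        (jacobiWeight lam β η θ : ℂ) = 0 := by
  set E : ℝ → ℂ := fun θ => Complex.exp ((k * Complex.I - η) * θ) with hE
  set F : ℝ → ℝ := fun θ => Real.sin (θ / 2) * (Real.sin (θ / 2) ^ 2) ^ lam *
    (Real.cos (θ / 2) * (Real.cos (θ / 2) ^ 2) ^ β) with hF
  have hFcont : Continuous F :=
    ((continuous_mul_sq_rpow hlam).comp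
      (by fun_prop : Continuous fun θ : ℝ => Real.sin (θ / 2))).mul
      ((continuous_mul_sq_rpow hβ).comp (by fun_prop : Continuous fun θ : ℝ => Real.cos (θ / 2)))
  have hcont : Continuous fun θ => 2 * E θ * (F θ : ℂ) :=
    Continuous.mul (by fun_prop) (Complex.continuous_ofReal.comp hFcont)
  have hexp : ∀ θ : ℝ, E θ = Complex.exp (k * θ * Complex.I) * Real.exp (-η * θ) := fun θ => by
    rw [hE, Complex.ofReal_exp, ← Complex.exp_add]
    push_cast
    ring_nf
  rw [MeasureTheory.integral_eq_of_hasDerivAt_off_countable_of_le (fun θ => 2 * E θ * (F θ : ℂ)) _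
    (by positivity) (Set.countable_singleton Real.pi) hcont.continuousOn ?_
    (intervalIntegrable_mul_weight (intervalIntegrable_jacobiWeight hlam hβ η) (by fun_prop))]
  · simp [hF]
  · rintro θ ⟨hθ, hne⟩
    have hsin : Real.sin (θ / 2) ≠ 0 := (sin_half_pos hθ.1 hθ.2).ne'
    have hcos : Real.cos (θ / 2) ≠ 0 := by
      rcases lt_or_gt_of_ne hne with h | h
      · exact (cos_half_pos hθ.1 h).ne'
      · exact (cos_half_neg h hθ.2).ne
    have hFd := ((hasDerivAt_mul_sq_rpow lam hsin).comp θ (hasDerivAt_sin_half θ)).mul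
      ((hasDerivAt_mul_sq_rpow β hcos).comp θ (hasDerivAt_cos_half θ))
    have hEd : HasDerivAt E ((k * Complex.I - η) * E θ) θ := by
      have h := ((hasDerivAt_id θ).ofReal_comp.const_mul (k * Complex.I - η : ℂ)).cexp
      refine h.congr_deriv ?_
      simp [hE, mul_comm]
    refine ((hEd.const_mul 2).mul hFd.ofReal_comp).congr_deriv ?_
    have hdouble : θ = 2 * (θ / 2) := by ring
    have hsin₂ : Real.sin θ = 2 * Real.sin (θ / 2) * Real.cos (θ / 2) := by
      conv_lhs => rw [hdouble, Real.sin_two_mul]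
    have hcos₂ : Real.cos θ = Real.cos (θ / 2) ^ 2 - Real.sin (θ / 2) ^ 2 := by
      conv_lhs => rw [hdouble, Real.cos_two_mul']
    have hone : (Real.sin (θ / 2) : ℂ) ^ 2 + (Real.cos (θ / 2) : ℂ) ^ 2 = 1 := by
      exact_mod_cast Real.sin_sq_add_cos_sq (θ / 2)
    simp only [hexp, jacobiWeight, hsin₂, hcos₂, Pi.mul_apply, Function.comp_apply]
    simp only [Complex.ofReal_mul, Complex.ofReal_add, Complex.ofReal_sub, Complex.ofReal_pow,
      Complex.ofReal_ofNat, Complex.ofReal_div, Complex.ofReal_neg, Complex.ofReal_one]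
    linear_combination Complex.exp (k * θ * Complex.I) * (Real.exp (-η * θ) : ℂ) *
      (((Real.sin (θ / 2) ^ 2) ^ lam : ℝ) : ℂ) * (((Real.cos (θ / 2) ^ 2) ^ β : ℝ) : ℂ) *
      (lam - β) * hone

theorem trigMoment_jacobiWeight (hlam : -1 / 2 < lam) (hβ : -1 / 2 < β) (η : ℝ) {d : ℂ}
    (hd : d = lam + β + η * Complex.I) (k : ℤ) :
    (k + 1 + d) * trigMoment (jacobiWeight lam β η) (k + 1) +
      (1 + (starRingEnd ℂ) d - k) * trigMoment (jacobiWeight lam β η) (k - 1) +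
      2 * (lam - β) * trigMoment (jacobiWeight lam β η) k = 0 := by
  have hinteg : ∀ j : ℤ, IntervalIntegrable
      (fun θ : ℝ => Complex.exp (j * θ * Complex.I) * (jacobiWeight lam β η θ : ℂ))
      volume 0 (2 * Real.pi) := fun j =>
    intervalIntegrable_mul_weight (intervalIntegrable_jacobiWeight hlam hβ η) (by fun_prop)
  have hconj : (starRingEnd ℂ) d = lam + β - η * Complex.I := by
    rw [hd]
    simp
    ring
  have h := integral_deriv_sin_mul_exp_mul_jacobiWeight hlam hβ η k
  rw [← mul_zero (2 : ℂ), ← h]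
  simp only [trigMoment]
  rw [← intervalIntegral.integral_const_mul, ← intervalIntegral.integral_const_mul,
    ← intervalIntegral.integral_const_mul, ← intervalIntegral.integral_add
      ((hinteg _).const_mul _) ((hinteg _).const_mul _), ← intervalIntegral.integral_add
      (((hinteg _).const_mul _).add ((hinteg _).const_mul _)) ((hinteg _).const_mul _),
    ← intervalIntegral.integral_const_mul]
  refine intervalIntegral.integral_congr fun θ _ => ?_
  have h₁ : Complex.exp (((k + 1 : ℤ) : ℂ) * θ * Complex.I) =
      Complex.exp (k * θ * Complex.I) * (Real.cos θ + Real.sin θ * Complex.I) := by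
    rw [Complex.ofReal_cos, Complex.ofReal_sin, ← Complex.exp_mul_I, ← Complex.exp_add]
    push_cast
    ring_nf
  have h₂ : Complex.exp (((k - 1 : ℤ) : ℂ) * θ * Complex.I) =
      Complex.exp (k * θ * Complex.I) * (Real.cos θ - Real.sin θ * Complex.I) := by
    have h : Complex.exp (-θ * Complex.I) = Real.cos θ - Real.sin θ * Complex.I := by
      rw [Complex.exp_mul_I, Complex.cos_neg, Complex.sin_neg, Complex.ofReal_cos,
        Complex.ofReal_sin]
      ring
    rw [← h, ← Complex.exp_add]
    push_cast
    ring_nf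
  simp only [h₁, h₂, hconj]
  rw [hd]
  linear_combination 2 * η * Real.sin θ * Complex.exp (k * θ * Complex.I) *
    (jacobiWeight lam β η θ : ℂ) * Complex.I_sq

end weight

theorem stmt_19
    (lam β η : ℝ) (hlam : -1/2 < lam) (hβ : -1/2 < β)
    (d : ℂ) (hd : d = (lam : ℂ) + (β : ℂ) + (η : ℂ) * Complex.I)
    (w : ℝ → ℝ)
    (hw : ∀ θ : ℝ, w θ = Real.exp (-η * θ) * (Real.sin (θ/2)^2) ^ lam * (Real.cos (θ/2)^2) ^ β)
    (Φ : ℕ → Polynomial ℂ)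
    (hmonic : ∀ n, (Φ n).Monic)
    (hdeg : ∀ n, (Φ n).natDegree = n)
    (horth : ∀ n, ∀ k < n,
      ∫ θ in (0:ℝ)..(2*Real.pi),
        (Φ n).eval (Complex.exp ((θ:ℂ) * Complex.I)) *
          Complex.exp (-(k : ℂ) * (θ:ℂ) * Complex.I) * (w θ : ℂ) = 0)
    (α : ℕ → ℂ)
    (hα : ∀ m, α m = -(starRingEnd ℂ) ((Φ (m+1)).coeff 0))
    (ℓ : ℕ → ℕ → ℂ)
    (hℓ : ∀ n k, ℓ n k = (Φ n).coeff k)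
    (Φs : ℕ → Polynomial ℂ)
    (hΦs : ∀ n, Φs n = ((Φ n).map (starRingEnd ℂ)).reverse)
    (n : ℕ) (hn : 3 ≤ n) :
    X * (X^2 - 1) * derivative (derivative (Φ n))
        + (C (d + 3 - (n:ℂ)) * X^2 + C (2 * ((lam:ℂ) - (β:ℂ))) * X
            + C ((starRingEnd ℂ) (d) + (n:ℂ) - 1)) * derivative (Φ n)
        - (C ((n:ℂ) * (d + 2)) * X
            - C ((d + (n:ℂ) + 1) * ℓ (n+1) n + 2 * (n:ℂ) * ((β:ℂ) - (lam:ℂ)))) * Φ n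
      = -(C ((d + (n:ℂ) + 1) * (starRingEnd ℂ) (α n)) * Φs n)
    ∧ X * (1 - X^2) * derivative (derivative (Φs n))
        - (C (d + 3 - (n:ℂ)) * X^2 + C (2 * ((lam:ℂ) - (β:ℂ))) * X
            + C ((starRingEnd ℂ) (d) + (n:ℂ) - 1)) * derivative (Φs n)
        + (C (d * ((n:ℂ) - 2)) * X
            - C (2 * (n:ℂ) * ((β:ℂ) - (lam:ℂ)) + (d + (n:ℂ)) * ℓ n (n-1)
                + (starRingEnd ℂ) (ℓ (n+1) n) + ((starRingEnd ℂ) (d) + (n:ℂ)) * α n * (starRingEnd ℂ) (α (n-1)))) * Φs n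
      = (C (2 * (d + (n:ℂ)) * α (n-1)) * X + C (((starRingEnd ℂ) (d) + (n:ℂ) + 1) * α n)) * Φ n := by
  set W := jacobiWeight lam β η
  have hwW : w = W := funext hw
  have hinteg : IntervalIntegrable W volume 0 (2 * Real.pi) :=
    intervalIntegrable_jacobiWeight hlam hβ η
  have hc : ∀ k, (starRingEnd ℂ) (trigMoment W k) = trigMoment W (-k) := conj_trigMoment
  have hrec := trigMoment_jacobiWeight hlam hβ η hd
  have hdef := eq_zero_of_momentForm_eq_zero hinteg (jacobiWeight_nonneg lam β η)
    fun θ hθ => jacobiWeight_pos lam β η hθ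
  have horth' : ∀ n k : ℕ, k < n → momentForm (trigMoment W) (-k) (Φ n) = 0 := fun n k hk => by
    rw [← integral_eval_exp_mul hinteg, ← horth n k hk, hwW]
    push_cast
    rfl
  have hfirst := odeOperator_orthogonal hc hrec hdef hmonic hdeg horth' (n := n) (by omega)
  have hsecond := odeOperator_conj_reverse hc hrec hdef hmonic hdeg horth' (n := n) (by omega)
  have hsum := coeff_add_conj_coeff hc hrec hdef hmonic hdeg horth' (n := n) (by omega)
  obtain ⟨m, rfl⟩ : ∃ m, n = m + 1 := ⟨n - 1, by omega⟩
  have hsum' := coeff_add_conj_coeff hc hrec hdef hmonic hdeg horth' (n := m) (by omega)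
  have hstep := coeff_succ_sub_coeff hc hdef hmonic hdeg horth' m
  have hstep' := congrArg (starRingEnd ℂ) hstep
  simp only [map_add, map_mul, Complex.conj_conj] at hstep'
  simp only [hℓ, hΦs, Nat.add_sub_cancel, hα]
  have e₁ : (d + ((m + 1 : ℕ) : ℂ) + 1) * (Φ (m + 1 + 1)).coeff (m + 1) +
      2 * ((m + 1 : ℕ) : ℂ) * ((β : ℂ) - (lam : ℂ)) =
      2 * (lam - β) - (1 + (starRingEnd ℂ) d + ((m + 1 : ℕ) : ℂ)) *
        (starRingEnd ℂ) ((Φ (m + 1 + 1)).coeff (m + 1)) := by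
    push_cast at hsum ⊢
    linear_combination hsum
  have e₂ : 2 * ((m + 1 : ℕ) : ℂ) * ((β : ℂ) - (lam : ℂ)) +
      (d + ((m + 1 : ℕ) : ℂ)) * (Φ (m + 1)).coeff m +
      (starRingEnd ℂ) ((Φ (m + 1 + 1)).coeff (m + 1)) +
      ((starRingEnd ℂ) d + ((m + 1 : ℕ) : ℂ)) *
        -(starRingEnd ℂ) ((Φ (m + 1 + 1)).coeff 0) *
        (starRingEnd ℂ) (-(starRingEnd ℂ) ((Φ (m + 1)).coeff 0)) =
      (((m + 1 : ℕ) : ℂ) + d - 1) * (Φ (m + 1 + 1)).coeff (m + 1) +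
        2 * (1 - ((m + 1 : ℕ) : ℂ)) * (lam - β) - 2 * (d + ((m + 1 : ℕ) : ℂ)) *
          (starRingEnd ℂ) ((Φ (m + 1)).coeff 0) * (Φ (m + 1 + 1)).coeff 0 := by
    rw [map_neg, Complex.conj_conj]
    push_cast at hsum hsum' ⊢
    linear_combination hsum - hsum' - ((starRingEnd ℂ) d + m + 1) * hstep' +
      (-2) * (d + m + 1) * hstep
  rw [e₁, e₂]
  rw [odeOperator] at hfirst hsecond
  simp only [map_add, map_sub, map_mul, map_neg, map_one, Complex.conj_conj]
    at hfirst hsecond ⊢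
  constructor
  · linear_combination hfirst
  · linear_combination hsecond
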